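/- Let b: M → ℝ be a 1-Lipschitz semiconcave function on a noncompact Alexandrov space M with curvature ≥ -1, such that for each x ∈ M the b-gradient curve σ_{+,x} starting at x is a unit-speed ray along which b increases at unit speed. Then for any geodesic γ and any point x = γ(t₀), the function t ↦ b∘γ(t) is supported from below at t₀ by t ↦ b(y) - d(y, γ(t)) for each y on σ_{+,x}, and consequently d_x b(γ⁺(t₀)) ≥ ⟨γ⁺(t₀), σ_{+,x}⁺(0)⟩; in particular b is semiconvex. -/

import Mathlib

open MeasureTheory Metric Filter Topology Set
open scoped ENNReal NNReal

noncomputable section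

/-- A unit-speed geodesic defined on `[0, L]`. -/
def IsUnitGeodesic {X : Type*} [MetricSpace X] (γ : ℝ → X) (L : ℝ) : Prop :=
  0 ≤ L ∧ ∀ s ∈ Set.Icc (0:ℝ) L, ∀ t ∈ Set.Icc (0:ℝ) L, dist (γ s) (γ t) = |s - t|

/-- A geodesic metric space: any two points are joined by a unit-speed geodesic. -/
def IsGeodesicSpace (X : Type*) [MetricSpace X] : Prop :=
  ∀ x y : X, ∃ γ : ℝ → X, IsUnitGeodesic γ (dist x y) ∧ γ 0 = x ∧ γ (dist x y) = y

/-- A (unit-speed) ray. -/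
def IsRay {X : Type*} [MetricSpace X] (γ : ℝ → X) : Prop :=
  ∀ s t : ℝ, 0 ≤ s → 0 ≤ t → dist (γ s) (γ t) = |s - t|

/-- Comparison angle in the hyperbolic plane (curvature `-1`), from the hyperbolic
law of cosines, for a triangle with side lengths `a, b` adjacent to the vertex and
opposite side `c`. -/
def cmpAngleH (a b c : ℝ) : ℝ :=
  Real.arccos ((Real.cosh a * Real.cosh b - Real.cosh c) / (Real.sinh a * Real.sinh b))

/-- Comparison angle in the Euclidean plane. -/
def cmpAngleE (a b c : ℝ) : ℝ :=
  Real.arccos ((a ^ 2 + b ^ 2 - c ^ 2) / (2 * a * b))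

/-- Comparison angle in the model plane of curvature `-K` (`K ≥ 0`). -/
def cmpAngleNeg (K a b c : ℝ) : ℝ :=
  if K = 0 then cmpAngleE a b c
  else cmpAngleH (Real.sqrt K * a) (Real.sqrt K * b) (Real.sqrt K * c)

/-- Alexandrov curvature `≥ -K` via the (1+3)-point comparison condition. -/
def CurvGeNegK (X : Type*) [MetricSpace X] (K : ℝ) : Prop :=
  IsGeodesicSpace X ∧
    ∀ p a b c : X, p ≠ a → p ≠ b → p ≠ c →
      cmpAngleNeg K (dist p a) (dist p b) (dist a b) +
          cmpAngleNeg K (dist p b) (dist p c) (dist b c) +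
          cmpAngleNeg K (dist p c) (dist p a) (dist c a) ≤ 2 * Real.pi

/-- Nonnegative Alexandrov curvature. -/
def CurvGeZero (X : Type*) [MetricSpace X] : Prop := CurvGeNegK X 0

/-- An `n`-dimensional Alexandrov space of curvature `≥ -1`. -/
def AlexandrovNegOne (X : Type*) [MetricSpace X] (n : ℕ) : Prop :=
  CurvGeNegK X 1 ∧ dimH (Set.univ : Set X) = n

/-- The pointwise Lipschitz constant `Lip f (x) = limsup_{y → x} |f y - f x| / d(x,y)`. -/
def lipConst {X : Type*} [MetricSpace X] (f : X → ℝ) (x : X) : ℝ :=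
  Filter.limsup (fun y => |f y - f x| / dist y x) (𝓝[≠] x)

/-- Lipschitz functions with compact support (test functions). -/
def TestFun {X : Type*} [MetricSpace X] (f : X → ℝ) : Prop :=
  (∃ K, LipschitzWith K f) ∧ HasCompactSupport f

/-- Bottom of the `L²`-spectrum of the Laplacian on `U`, via the Rayleigh quotient with
the pointwise Lipschitz constant as gradient norm. -/
def lambda0 {X : Type*} [MetricSpace X] [MeasurableSpace X] (vol : Measure X)
    (U : Set X) : ℝ :=
  sInf { r : ℝ | ∃ f : X → ℝ, TestFun f ∧ tsupport f ⊆ U ∧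
    (∫ x, f x ^ 2 ∂vol) ≠ 0 ∧
    r = (∫ x, lipConst f x ^ 2 ∂vol) / ∫ x, f x ^ 2 ∂vol }

/-- An abstract carré-du-champ ("scalar product of gradients") structure, compatible
with the metric-measure structure. -/
structure GradStruct (X : Type*) [MetricSpace X] [MeasurableSpace X] (vol : Measure X) where
  ip : (X → ℝ) → (X → ℝ) → X → ℝ
  symm : ∀ f g, ip f g = ip g f
  nonneg : ∀ f x, 0 ≤ ip f f x
  lip_eq : ∀ f : X → ℝ, (∃ K, LipschitzWith K f) →
    ip f f =ᵐ[vol] fun x => lipConst f x ^ 2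
  chain : ∀ (Φ : ℝ → ℝ), ContDiff ℝ 1 Φ → ∀ f g : X → ℝ,
    ip (fun x => Φ (f x)) g =ᵐ[vol] fun x => deriv Φ (f x) * ip f g x

/-- `ℒ_f = g · vol` in the distributional sense. -/
def LapEq {X : Type*} [MetricSpace X] [MeasurableSpace X] {vol : Measure X}
    (G : GradStruct X vol) (f g : X → ℝ) : Prop :=
  ∀ φ : X → ℝ, TestFun φ → -∫ x, G.ip f φ x ∂vol = ∫ x, g x * φ x ∂vol

/-- `ℒ_f ≤ g · vol` in the distributional sense. -/
def LapLe {X : Type*} [MetricSpace X] [MeasurableSpace X] {vol : Measure X}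
    (G : GradStruct X vol) (f g : X → ℝ) : Prop :=
  ∀ φ : X → ℝ, TestFun φ → (∀ x, 0 ≤ φ x) →
    -∫ x, G.ip f φ x ∂vol ≤ ∫ x, g x * φ x ∂vol

/-- `ℒ_f ≥ g · vol` in the distributional sense. -/
def LapGe {X : Type*} [MetricSpace X] [MeasurableSpace X] {vol : Measure X}
    (G : GradStruct X vol) (f g : X → ℝ) : Prop :=
  ∀ φ : X → ℝ, TestFun φ → (∀ x, 0 ≤ φ x) →
    ∫ x, g x * φ x ∂vol ≤ -∫ x, G.ip f φ x ∂vol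

/-- `f` is harmonic on `U` (distributionally). -/
def HarmonicOn {X : Type*} [MetricSpace X] [MeasurableSpace X] {vol : Measure X}
    (G : GradStruct X vol) (f : X → ℝ) (U : Set X) : Prop :=
  ∀ φ : X → ℝ, TestFun φ → tsupport φ ⊆ U → ∫ x, G.ip f φ x ∂vol = 0

/-- `f` is subharmonic on `U` (`ℒ_f ≥ 0` distributionally). -/
def SubharmonicOn {X : Type*} [MetricSpace X] [MeasurableSpace X] {vol : Measure X}
    (G : GradStruct X vol) (f : X → ℝ) (U : Set X) : Prop :=
  ∀ φ : X → ℝ, TestFun φ → (∀ x, 0 ≤ φ x) → tsupport φ ⊆ U →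
    ∫ x, G.ip f φ x ∂vol ≤ 0

/-- Local `W^{1,2}` membership: square-integrable with square-integrable gradient
on every compact set. -/
def W12loc {X : Type*} [MetricSpace X] [MeasurableSpace X] {vol : Measure X}
    (G : GradStruct X vol) (f : X → ℝ) : Prop :=
  ∀ K : Set X, IsCompact K →
    IntegrableOn (fun x => f x ^ 2) K vol ∧ IntegrableOn (G.ip f f) K vol

/-- `f` is `l`-concave on `U`: along every geodesic in `U`, `f ∘ γ - l t²/2` is concave. -/
def SemiconcaveWith {X : Type*} [MetricSpace X] (f : X → ℝ) (U : Set X) (l : ℝ) : Prop :=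
  ∀ γ : ℝ → X, ∀ L : ℝ, IsUnitGeodesic γ L → (∀ t ∈ Set.Icc (0:ℝ) L, γ t ∈ U) →
    ConcaveOn ℝ (Set.Icc 0 L) fun t => f (γ t) - l * t ^ 2 / 2

/-- `f` is semiconcave: locally `l`-concave for some `l`. -/
def Semiconcave {X : Type*} [MetricSpace X] (f : X → ℝ) : Prop :=
  ∀ x : X, ∃ U ∈ 𝓝 x, ∃ l : ℝ, SemiconcaveWith f U l

/-- `f` is semiconvex. -/
def Semiconvex {X : Type*} [MetricSpace X] (f : X → ℝ) : Prop :=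
  Semiconcave fun x => -f x

/-- `f` is `(-1)`-affine: along every unit-speed geodesic, `(f ∘ γ)'' = f ∘ γ`. -/
def NegOneAffine {X : Type*} [MetricSpace X] (f : X → ℝ) : Prop :=
  ∀ γ : ℝ → X, ∀ L : ℝ, IsUnitGeodesic γ L → ∃ g' : ℝ → ℝ,
    (∀ t ∈ Set.Icc (0:ℝ) L, HasDerivWithinAt (fun s => f (γ s)) (g' t) (Set.Icc 0 L) t) ∧
    ∀ t ∈ Set.Icc (0:ℝ) L, HasDerivWithinAt g' (f (γ t)) (Set.Icc 0 L) t

/-- The cosine of the angle between two curves emanating from a common point,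
via Euclidean comparison angles. -/
def cosAngleAt {X : Type*} [MetricSpace X] (c₁ c₂ : ℝ → X) : ℝ :=
  Filter.limsup
    (fun st : ℝ × ℝ =>
      (st.1 ^ 2 + st.2 ^ 2 - dist (c₁ st.1) (c₂ st.2) ^ 2) / (2 * st.1 * st.2))
    ((𝓝[>] (0:ℝ)) ×ˢ (𝓝[>] (0:ℝ)))

/-- Inverse hyperbolic cosine. -/
def acoshR (x : ℝ) : ℝ := Real.log (x + Real.sqrt (x ^ 2 - 1))

/-- The distance in the warped product `ℝ ×_{e^t} N` between points over fiber distance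
`dN` and base coordinates `s, t`:
`cosh d = cosh (s - t) + e^{s+t} dN² / 2`. -/
def warpDist (dN s t : ℝ) : ℝ :=
  acoshR (Real.cosh (s - t) + Real.exp (s + t) * dN ^ 2 / 2)

/-- The data of a splitting `X = ℝ ×_{e^t} N` with `N` a compact nonnegatively curved
Alexandrov space. -/
structure WarpSplitCompactData (X : Type*) [MetricSpace X] where
  (N : Type)
  [instN : MetricSpace N]
  (compactN : CompactSpace N)
  (curvN : CurvGeZero N)
  (Φ : X → ℝ × N)
  (bij : Function.Bijective Φ)
  (dist_eq : ∀ u v : X, dist u v = warpDist (dist (Φ u).2 (Φ v).2) (Φ u).1 (Φ v).1)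

/-- The data of a splitting `X = ℝ ×_{e^t} N` with `N` an `m`-dimensional nonnegatively
curved Alexandrov space. -/
structure WarpSplitDimData (X : Type*) [MetricSpace X] (m : ℕ) where
  (N : Type)
  [instN : MetricSpace N]
  (curvN : CurvGeZero N)
  (dimN : dimH (Set.univ : Set N) = m)
  (Φ : X → ℝ × N)
  (bij : Function.Bijective Φ)
  (dist_eq : ∀ u v : X, dist u v = warpDist (dist (Φ u).2 (Φ v).2) (Φ u).1 (Φ v).1)

/-- `X` is isometric to hyperbolic `k`-space `ℍ^k = ℝ ×_{e^t} ℝ^{k-1}` (in horocyclic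
coordinates). -/
def IsometricToHypSpace (X : Type*) [MetricSpace X] (k : ℕ) : Prop :=
  ∃ Φ : X → ℝ × EuclideanSpace ℝ (Fin (k - 1)), Function.Bijective Φ ∧
    ∀ u v : X, dist u v = warpDist (dist (Φ u).2 (Φ v).2) (Φ u).1 (Φ v).1

/-- An end of `X` with respect to the ball `B_p(R₀)`: an unbounded connected component
of the complement of the closed ball. -/
def IsEnd {X : Type*} [MetricSpace X] (p : X) (R₀ : ℝ) (E : Set X) : Prop :=
  (∃ x ∈ (Metric.closedBall p R₀)ᶜ, E = connectedComponentIn (Metric.closedBall p R₀)ᶜ x) ∧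
    ¬Bornology.IsBounded E

/-- The (2-)capacity of a set. -/
def cap2 {X : Type*} [MetricSpace X] [MeasurableSpace X] (vol : Measure X)
    (A : Set X) : ℝ≥0∞ :=
  ⨅ (u : X → ℝ) (_ : ∃ K, LipschitzWith K u) (_ : ∀ x ∈ A, 1 ≤ u x),
    ∫⁻ x, ENNReal.ofReal (u x ^ 2 + lipConst u x ^ 2) ∂vol

/-- A property holds quasi-everywhere on `A`. -/
def QEOn {X : Type*} [MetricSpace X] [MeasurableSpace X] (vol : Measure X)
    (A : Set X) (P : X → Prop) : Prop :=
  ∃ Z : Set X, cap2 vol Z = 0 ∧ ∀ x ∈ A \ Z, P x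

/-- `h` solves the Dirichlet problem on `E(R) = E ∩ B_p(R)` with boundary value `1`
on `∂E` and `0` on `∂E(R)`, attained quasi-everywhere. -/
def EndDirichlet {X : Type*} [MetricSpace X] [MeasurableSpace X] {vol : Measure X}
    (G : GradStruct X vol) (p : X) (E : Set X) (R : ℝ) (h : X → ℝ) : Prop :=
  HarmonicOn G h (E ∩ Metric.ball p R) ∧ (∀ x, 0 ≤ h x ∧ h x ≤ 1) ∧
    QEOn vol (frontier E) (fun x => Tendsto h (𝓝[E ∩ Metric.ball p R] x) (𝓝 1)) ∧
    QEOn vol (E ∩ Metric.sphere p R) (fun x => Tendsto h (𝓝[E ∩ Metric.ball p R] x) (𝓝 0))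

/-- A non-parabolic end: the Dirichlet harmonic functions `h_{R_i}` converge to a
nonconstant harmonic function on `E`. -/
def NonParabolicEnd {X : Type*} [MetricSpace X] [MeasurableSpace X] {vol : Measure X}
    (G : GradStruct X vol) (p : X) (R₀ : ℝ) (E : Set X) : Prop :=
  IsEnd p R₀ E ∧ ∃ (R : ℕ → ℝ) (h : ℕ → X → ℝ) (h' : X → ℝ),
    (∀ i, R₀ < R i) ∧ Tendsto R atTop atTop ∧
    (∀ i, EndDirichlet G p E (R i) (h i)) ∧
    TendstoLocallyUniformlyOn h h' atTop E ∧
    ∃ x ∈ E, ∃ y ∈ E, h' x ≠ h' y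

/-- A parabolic end. -/
def ParabolicEnd {X : Type*} [MetricSpace X] [MeasurableSpace X] {vol : Measure X}
    (G : GradStruct X vol) (p : X) (R₀ : ℝ) (E : Set X) : Prop :=
  IsEnd p R₀ E ∧ ¬NonParabolicEnd G p R₀ E

end

section HyperbolicEstimates

/-- `sinh x ≤ x cosh x` for nonnegative `x`. -/
theorem sinh_le_mul_cosh {x : ℝ} (hx : 0 ≤ x) : Real.sinh x ≤ x * Real.cosh x := by
  refine hasSum_le (fun n => ?_) (Real.hasSum_sinh x) ((Real.hasSum_cosh x).mul_left x)
  have h : ((2 * n).factorial : ℝ) ≤ ((2 * n + 1).factorial : ℝ) := by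
    exact_mod_cast Nat.factorial_le (Nat.le_succ _)
  calc x ^ (2 * n + 1) / ((2 * n + 1).factorial : ℝ)
      ≤ x ^ (2 * n + 1) / ((2 * n).factorial : ℝ) := by gcongr
    _ = x * (x ^ (2 * n) / ((2 * n).factorial : ℝ)) := by ring

theorem cosh_le_one_add_sq {x : ℝ} (h0 : 0 ≤ x) (h1 : x ≤ 1) :
    Real.cosh x ≤ 1 + x ^ 2 := by
  refine (Real.cosh_le_exp_half_sq x).trans ?_
  have h := Real.add_one_le_exp (-(x ^ 2 / 2))
  have hm : Real.exp (x ^ 2 / 2) * Real.exp (-(x ^ 2 / 2)) = 1 := by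
    rw [← Real.exp_add]; simp
  have hp := Real.exp_pos (x ^ 2 / 2)
  have hx : x ^ 2 ≤ 1 := by nlinarith
  have h2 : Real.exp (x ^ 2 / 2) * (1 - x ^ 2 / 2) ≤ 1 := by nlinarith
  by_contra! hc
  nlinarith [sq_nonneg x, mul_nonneg (sq_nonneg x) (sub_nonneg.2 hx)]

theorem sinh_le_self_add_cube {x : ℝ} (h0 : 0 ≤ x) (h1 : x ≤ 1) :
    Real.sinh x ≤ x + x ^ 3 := by
  have := mul_le_mul_of_nonneg_left (cosh_le_one_add_sq h0 h1) h0
  nlinarith [sinh_le_mul_cosh h0]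

/-- The graph of `cosh` lies above its tangent lines. -/
theorem cosh_add_sinh_mul_le (a d : ℝ) :
    Real.cosh a + Real.sinh a * (d - a) ≤ Real.cosh d := by
  have h1 := mul_le_mul_of_nonneg_left (Real.add_one_le_exp (d - a)) (Real.exp_pos a).le
  have h2 := mul_le_mul_of_nonneg_left (Real.add_one_le_exp (-(d - a))) (Real.exp_pos (-a)).le
  rw [← Real.exp_add] at h1 h2
  rw [show a + (d - a) = d by ring] at h1
  rw [show -a + -(d - a) = -d by ring] at h2
  rw [Real.cosh_eq, Real.sinh_eq, Real.cosh_eq]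
  linarith

/-- Hyperbolic comparison angles do not exceed Euclidean ones. -/
theorem cosE_le_cosH {a b c : ℝ} (ha : 0 < a) (hb : 0 < b)
    (h1 : |a - b| ≤ c) (h2 : c ≤ a + b) :
    (a ^ 2 + b ^ 2 - c ^ 2) / (2 * a * b) ≤
      (Real.cosh a * Real.cosh b - Real.cosh c) / (Real.sinh a * Real.sinh b) := by
  have hab : 0 < 2 * a * b := by positivity
  set F := (a ^ 2 + b ^ 2 - c ^ 2) / (2 * a * b) with hF
  have hc0 : 0 ≤ c := (abs_nonneg _).trans h1
  have hFm : F * (2 * a * b) = a ^ 2 + b ^ 2 - c ^ 2 := div_mul_cancel₀ _ hab.ne'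
  have hsq : (a - b) ^ 2 ≤ c ^ 2 := by
    rw [← sq_abs (a - b)]; gcongr
  have hsq2 : c ^ 2 ≤ (a + b) ^ 2 := by gcongr
  have hF1 : F ≤ 1 := by rw [hF, div_le_one hab]; linarith
  have hF2 : -1 ≤ F := by rw [hF, le_div_iff₀ hab]; linarith
  have hcvx : Real.cosh c ≤
      (1 + F) / 2 * Real.cosh (a - b) + (1 - F) / 2 * Real.cosh (a + b) := by
    refine hasSum_le (fun n => ?_) (Real.hasSum_cosh c)
      (((Real.hasSum_cosh (a - b)).mul_left _).add ((Real.hasSum_cosh (a + b)).mul_left _))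
    have := (convexOn_pow (𝕜 := ℝ) n).2 (mem_Ici.2 (sq_nonneg (a - b)))
      (mem_Ici.2 (sq_nonneg (a + b))) (show 0 ≤ (1 + F) / 2 by linarith)
      (show 0 ≤ (1 - F) / 2 by linarith) (by ring)
    simp only [smul_eq_mul] at this
    have he : (1 + F) / 2 * (a - b) ^ 2 + (1 - F) / 2 * (a + b) ^ 2 = c ^ 2 := by
      linear_combination -hFm
    rw [he] at this
    have hfac : (0 : ℝ) < ((2 * n).factorial : ℝ) := by positivity
    simp only [pow_mul]
    rw [← mul_div_assoc, ← mul_div_assoc, ← add_div]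
    gcongr
  have hs : 0 < Real.sinh a * Real.sinh b :=
    mul_pos (Real.sinh_pos_iff.2 ha) (Real.sinh_pos_iff.2 hb)
  rw [le_div_iff₀ hs]
  rw [Real.cosh_sub, Real.cosh_add] at hcvx
  nlinarith

theorem cosH_mem_Icc {a b c : ℝ} (ha : 0 < a) (hb : 0 < b)
    (h1 : |a - b| ≤ c) (h2 : c ≤ a + b) :
    (Real.cosh a * Real.cosh b - Real.cosh c) / (Real.sinh a * Real.sinh b) ∈
      Set.Icc (-1 : ℝ) 1 := by
  have hs : 0 < Real.sinh a * Real.sinh b :=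
    mul_pos (Real.sinh_pos_iff.2 ha) (Real.sinh_pos_iff.2 hb)
  have hc0 : 0 ≤ c := (abs_nonneg _).trans h1
  have e1 : Real.cosh (a - b) ≤ Real.cosh c := by
    rw [Real.cosh_le_cosh, abs_of_nonneg hc0]; exact h1
  have e2 : Real.cosh c ≤ Real.cosh (a + b) := by
    rw [Real.cosh_le_cosh, abs_of_nonneg hc0, abs_of_nonneg (by linarith)]; exact h2
  rw [Real.cosh_sub] at e1
  rw [Real.cosh_add] at e2
  constructor
  · rw [le_div_iff₀ hs]; linarith
  · rw [div_le_one hs]; linarith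

/-- First order estimate relating the hyperbolic comparison angle to the difference quotient
of the distance function. -/
theorem cosH_le_difference_quotient {h d : ℝ} (hh : 0 < h) (hh1 : h ≤ 1) (hd : d - 1 ≤ h) :
    (Real.cosh h * Real.cosh 1 - Real.cosh d) / (Real.sinh h * Real.sinh 1) ≤
      (1 - d) / h + (Real.cosh 1 / Real.sinh 1 + 1) * h := by
  have hs1 : 0 < Real.sinh 1 := Real.sinh_pos_iff.2 one_pos
  have hshp := Real.sinh_pos_iff.2 hh
  have ht := cosh_add_sinh_mul_le 1 d
  set C := Real.cosh 1 / Real.sinh 1 with hCdef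
  have hC0 : 0 ≤ C := div_nonneg (Real.cosh_pos 1).le hs1.le
  have hc1 : Real.cosh 1 = C * Real.sinh 1 := (div_mul_cancel₀ _ hs1.ne').symm
  set q := (1 - d) / h with hq
  have hqh : 1 - d = q * h := (div_mul_cancel₀ _ hh.ne').symm
  have hq1 : -1 ≤ q := by rw [hq, le_div_iff₀ hh]; linarith
  have sh := sinh_le_self_add_cube hh.le hh1
  have sh' := Real.self_le_sinh_iff.2 hh.le
  have ch := cosh_le_one_add_sq hh.le hh1
  have e1 : C * (Real.cosh h - 1) ≤ C * h * Real.sinh h := by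
    rw [mul_assoc]
    exact mul_le_mul_of_nonneg_left (by nlinarith) hC0
  have e2 : q * (h - Real.sinh h) ≤ h * Real.sinh h := by
    have h3 : h ^ 3 ≤ h * h := by nlinarith [mul_pos hh hh]
    nlinarith [mul_nonneg (by linarith : (0 : ℝ) ≤ q + 1) (sub_nonneg.2 sh')]
  rw [div_le_iff₀ (by positivity)]
  have e3 := mul_le_mul_of_nonneg_left (add_le_add e1 e2) hs1.le
  have hd' : d - 1 = -(q * h) := by linarith
  rw [hc1, hd'] at ht
  rw [hc1]
  linarith

end HyperbolicEstimates

section Comparison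

variable {X : Type*} [MetricSpace X]

theorem abs_dist_sub_dist_le (p x y : X) : |dist p x - dist p y| ≤ dist x y := by
  rw [dist_comm p x, dist_comm p y]
  exact abs_dist_sub_le x y p

/-- Point-on-a-side comparison in curvature `≥ -1`: for `p` between `x` and `z`, the function
`cosh (dist y ·)` at `p` dominates its hyperbolic interpolation from `x` and `z`. -/
theorem CurvGeNegK.sinh_mul_cosh_le (hC : CurvGeNegK X 1) {x p z : X} (y : X) {h k : ℝ}
    (hh : 0 < h) (hk : 0 < k) (hxp : dist p x = h) (hpz : dist p z = k)
    (hxz : dist x z = h + k) :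
    Real.sinh k * Real.cosh (dist y x) + Real.sinh h * Real.cosh (dist y z) ≤
      Real.sinh (h + k) * Real.cosh (dist y p) := by
  rcases eq_or_ne p y with rfl | hpy
  · rw [hxp, hpz, dist_self, Real.cosh_zero, Real.sinh_add]
    linarith
  have hpx : p ≠ x := dist_pos.1 (hxp ▸ hh)
  have hpz' : p ≠ z := dist_pos.1 (hpz ▸ hk)
  have hcmp := hC.2 p x y z hpx hpy hpz'
  have hd : 0 < dist p y := dist_pos.2 hpy
  simp only [cmpAngleNeg, one_ne_zero, if_false, Real.sqrt_one, one_mul, cmpAngleH] at hcmp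
  have hshp := Real.sinh_pos_iff.2 hh
  have hskp := Real.sinh_pos_iff.2 hk
  have hsdp := Real.sinh_pos_iff.2 hd
  have hpi : Real.arccos ((Real.cosh (dist p z) * Real.cosh (dist p x) - Real.cosh (dist z x)) /
      (Real.sinh (dist p z) * Real.sinh (dist p x))) = Real.pi := by
    rw [hxp, hpz, dist_comm z x, hxz, Real.cosh_add]
    rw [show (Real.cosh k * Real.cosh h - (Real.cosh h * Real.cosh k + Real.sinh h * Real.sinh k)) /
      (Real.sinh k * Real.sinh h) = -1 by field_simp; ring]
    exact Real.arccos_neg_one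
  rw [hpi] at hcmp
  have m1 := cosH_mem_Icc (dist_pos.2 hpx) hd (abs_dist_sub_dist_le p x y)
    (dist_triangle_left x y p)
  have m2 := cosH_mem_Icc hd (dist_pos.2 hpz') (abs_dist_sub_dist_le p y z)
    (dist_triangle_left y z p)
  set u := (Real.cosh (dist p x) * Real.cosh (dist p y) - Real.cosh (dist x y)) /
    (Real.sinh (dist p x) * Real.sinh (dist p y)) with hu
  set v := (Real.cosh (dist p y) * Real.cosh (dist p z) - Real.cosh (dist y z)) /
    (Real.sinh (dist p y) * Real.sinh (dist p z)) with hv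
  have huv : -v ≤ u := by
    have h1 : Real.arccos u ≤ Real.arccos (-v) := by rw [Real.arccos_neg]; linarith
    exact (Real.strictAntiOn_arccos.le_iff_ge m1
      (by constructor <;> linarith [m2.1, m2.2])).1 h1
  rw [hxp] at hu
  rw [hpz] at hv
  have hu' : u * (Real.sinh h * Real.sinh (dist p y)) =
      Real.cosh h * Real.cosh (dist p y) - Real.cosh (dist x y) := by
    rw [hu]; exact div_mul_cancel₀ _ (by positivity)
  have hv' : v * (Real.sinh (dist p y) * Real.sinh k) =
      Real.cosh (dist p y) * Real.cosh k - Real.cosh (dist y z) := by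
    rw [hv]; exact div_mul_cancel₀ _ (by positivity)
  have key : 0 ≤ (u + v) * (Real.sinh h * Real.sinh k * Real.sinh (dist p y)) :=
    mul_nonneg (by linarith) (by positivity)
  rw [Real.sinh_add, dist_comm y x, dist_comm y p]
  linear_combination key + Real.sinh k * hu' + Real.sinh h * hv'

/-- The cosine of the hyperbolic comparison angle at `x` is monotone in the length of a side. -/
theorem CurvGeNegK.cosH_le_cosH (hC : CurvGeNegK X 1) {x p z y : X} {h k : ℝ}
    (hh : 0 < h) (hk : 0 ≤ k) (hxp : dist p x = h) (hpz : dist p z = k)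
    (hxz : dist x z = h + k) (hyx : y ≠ x) :
    (Real.cosh h * Real.cosh (dist y x) - Real.cosh (dist y p)) /
        (Real.sinh h * Real.sinh (dist y x)) ≤
      (Real.cosh (h + k) * Real.cosh (dist y x) - Real.cosh (dist y z)) /
        (Real.sinh (h + k) * Real.sinh (dist y x)) := by
  rcases hk.eq_or_lt with rfl | hk
  · rw [dist_eq_zero.1 hpz, add_zero]
  have hkey := hC.sinh_mul_cosh_le y hh hk hxp hpz hxz
  have hshp := Real.sinh_pos_iff.2 hh
  have hskp := Real.sinh_pos_iff.2 hk
  have hsdp := Real.sinh_pos_iff.2 (dist_pos.2 hyx)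
  have hhk := Real.sinh_pos_iff.2 (add_pos hh hk)
  rw [div_le_div_iff₀ (by positivity) (by positivity)]
  have hid : Real.sinh (h + k) * Real.cosh h - Real.sinh h * Real.cosh (h + k) =
      Real.sinh k := by
    rw [Real.sinh_add, Real.cosh_add]
    linear_combination Real.sinh k * Real.cosh_sq h
  have := mul_le_mul_of_nonneg_right hkey hsdp.le
  linear_combination this + Real.sinh (dist y x) * Real.cosh (dist y x) * hid

/-- One-sided second order estimate for a distance function along a geodesic at distance `1`. -/
theorem CurvGeNegK.dist_interpolation_le (hC : CurvGeNegK X 1) {x p z y : X} {h k : ℝ}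
    (hh : 0 < h) (hk : 0 < k) (hh1 : h ≤ 1) (hk1 : k ≤ 1) (hxp : dist p x = h)
    (hpz : dist p z = k) (hxz : dist x z = h + k) (hyp : dist y p = 1) :
    k * (dist y x - 1) + h * (dist y z - 1) ≤
      (2 + 4 * (Real.cosh 1 / Real.sinh 1)) * (h * k * (h + k)) := by
  have hkey := hC.sinh_mul_cosh_le y hh hk hxp hpz hxz
  rw [hyp] at hkey
  have hs1 : 0 < Real.sinh 1 := Real.sinh_pos_iff.2 one_pos
  have hshp := Real.sinh_pos_iff.2 hh
  have hskp := Real.sinh_pos_iff.2 hk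
  set C := Real.cosh 1 / Real.sinh 1 with hCdef
  have hC0 : 0 ≤ C := div_nonneg (Real.cosh_pos 1).le hs1.le
  have hc1 : Real.cosh 1 = C * Real.sinh 1 := (div_mul_cancel₀ _ hs1.ne').symm
  have t1 := mul_le_mul_of_nonneg_left (cosh_add_sinh_mul_le 1 (dist y x)) hskp.le
  have t2 := mul_le_mul_of_nonneg_left (cosh_add_sinh_mul_le 1 (dist y z)) hshp.le
  have b1 : Real.sinh k * (dist y x - 1) + Real.sinh h * (dist y z - 1) ≤
      C * (Real.sinh (h + k) - Real.sinh h - Real.sinh k) := by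
    refine le_of_mul_le_mul_left ?_ hs1
    rw [hc1] at hkey t1 t2
    linarith
  have b2 : Real.sinh (h + k) - Real.sinh h - Real.sinh k ≤ 4 * (h * k * (h + k)) := by
    have ch := cosh_le_one_add_sq hh.le hh1
    have ck := cosh_le_one_add_sq hk.le hk1
    have sh : Real.sinh h ≤ 2 * h := by
      nlinarith [sinh_le_self_add_cube hh.le hh1, pow_le_of_le_one hh.le hh1 three_ne_zero]
    have sk : Real.sinh k ≤ 2 * k := by
      nlinarith [sinh_le_self_add_cube hk.le hk1, pow_le_of_le_one hk.le hk1 three_ne_zero]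
    have e1 : Real.sinh h * (Real.cosh k - 1) ≤ 2 * h * k ^ 2 :=
      mul_le_mul sh (by linarith) (by linarith [Real.one_le_cosh k]) (by positivity)
    have e2 : Real.sinh k * (Real.cosh h - 1) ≤ 2 * k * h ^ 2 :=
      mul_le_mul sk (by linarith) (by linarith [Real.one_le_cosh h]) (by positivity)
    rw [Real.sinh_add]
    have : 0 < h * k * (h + k) := by positivity
    nlinarith
  have d1 : 1 - dist y x ≤ h := by
    have := dist_triangle y x p
    rw [dist_comm x p] at this
    linarith
  have d2 : 1 - dist y z ≤ k := by
    have := dist_triangle y z p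
    rw [dist_comm z p] at this
    linarith
  have sk := sinh_le_self_add_cube hk.le hk1
  have sh := sinh_le_self_add_cube hh.le hh1
  have sk' := Real.self_le_sinh_iff.2 hk.le
  have sh' := Real.self_le_sinh_iff.2 hh.le
  have c1 : (Real.sinh k - k) * (1 - dist y x) ≤ k ^ 3 * h := by
    calc (Real.sinh k - k) * (1 - dist y x) ≤ (Real.sinh k - k) * h :=
          mul_le_mul_of_nonneg_left d1 (by linarith)
      _ ≤ k ^ 3 * h := mul_le_mul_of_nonneg_right (by linarith) hh.le
  have c2 : (Real.sinh h - h) * (1 - dist y z) ≤ h ^ 3 * k := by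
    calc (Real.sinh h - h) * (1 - dist y z) ≤ (Real.sinh h - h) * k :=
          mul_le_mul_of_nonneg_left d2 (by linarith)
      _ ≤ h ^ 3 * k := mul_le_mul_of_nonneg_right (by linarith) hk.le
  have c3 : k ^ 3 * h + h ^ 3 * k ≤ 2 * (h * k * (h + k)) := by
    have : h * k * (k ^ 2 + h ^ 2) ≤ h * k * (h + k) :=
      mul_le_mul_of_nonneg_left (by nlinarith) (by positivity)
    have : 0 < h * k * (h + k) := by positivity
    nlinarith
  have b3 := mul_le_mul_of_nonneg_left b2 hC0
  linarith


end Comparison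

section GradientRays

variable {X : Type*} [MetricSpace X]

/-- A `1`-Lipschitz function bounds from above each of the distance functions supporting it. -/
theorem LipschitzWith.sub_dist_le {b : X → ℝ} (hlip : LipschitzWith 1 b) (y z : X) :
    b y - dist y z ≤ b z := by
  have := hlip.dist_le_mul y z
  rw [Real.dist_eq, NNReal.coe_one, one_mul] at this
  linarith [le_abs_self (b y - b z)]

theorem IsRay.dist_zero {c : ℝ → X} (hc : IsRay c) {s : ℝ} (hs : 0 ≤ s) :
    dist (c s) (c 0) = s := by
  rw [hc s 0 hs le_rfl, sub_zero, abs_of_nonneg hs]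

theorem IsUnitGeodesic.dist_add {γ : ℝ → X} {L t₀ u v : ℝ} (hγ : IsUnitGeodesic γ L)
    (ht : 0 ≤ t₀) (hu : 0 ≤ u) (huv : u ≤ v) (hv : t₀ + v ≤ L) :
    dist (γ (t₀ + v)) (γ (t₀ + u)) = v - u := by
  rw [hγ.2 _ ⟨by linarith, hv⟩ _ ⟨by linarith, by linarith⟩, add_sub_add_left_eq_sub,
    abs_of_nonneg (by linarith)]

/-- In curvature `≥ -1`, the angle between a geodesic and a ray is bounded by any hyperbolic
comparison angle. -/
theorem CurvGeNegK.cosAngleAt_le (hC : CurvGeNegK X 1) {γ : ℝ → X} {L t₀ h₀ s₀ : ℝ}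
    (hγ : IsUnitGeodesic γ L) (ht : 0 ≤ t₀) (hh₀ : 0 < h₀) (hL : t₀ + h₀ ≤ L) (hs₀ : 0 < s₀)
    {c : ℝ → X} (hc : IsRay c) (hc0 : c 0 = γ t₀) :
    cosAngleAt (fun h => γ (t₀ + h)) c ≤
      (Real.cosh h₀ * Real.cosh s₀ - Real.cosh (dist (c s₀) (γ (t₀ + h₀)))) /
        (Real.sinh h₀ * Real.sinh s₀) := by
  have hev : ∀ᶠ st : ℝ × ℝ in (𝓝[>] (0 : ℝ)) ×ˢ (𝓝[>] (0 : ℝ)),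
      st.1 ∈ Set.Ioo 0 h₀ ∧ st.2 ∈ Set.Ioo 0 s₀ :=
    prod_mem_prod (Ioo_mem_nhdsGT hh₀) (Ioo_mem_nhdsGT hs₀)
  have hγd : ∀ h : ℝ, 0 ≤ h → h ≤ h₀ → dist (γ (t₀ + h)) (γ t₀) = h := fun h h0 h1 => by
    have := hγ.dist_add ht le_rfl h0 (by linarith)
    rwa [add_zero, sub_zero] at this
  have hcd : ∀ s : ℝ, 0 ≤ s → dist (c s) (γ t₀) = s := fun s hs => hc0 ▸ hc.dist_zero hs
  refine limsup_le_of_le (isCoboundedUnder_le_of_eventually_le _ (x := -1) ?_) ?_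
  · filter_upwards [hev] with ⟨h, s⟩ ⟨⟨h0, h1⟩, s0, _⟩
    dsimp only at h0 h1 s0 ⊢
    have htri := dist_triangle_right (γ (t₀ + h)) (c s) (γ t₀)
    rw [hγd h h0.le h1.le, hcd s s0.le] at htri
    rw [le_div_iff₀ (by positivity)]
    nlinarith [dist_nonneg (x := γ (t₀ + h)) (y := c s)]
  · filter_upwards [hev] with ⟨h, s⟩ ⟨⟨h0, h1⟩, s0, s1⟩
    dsimp only at h0 h1 s0 s1 ⊢
    have hne : c s ≠ γ t₀ := dist_pos.1 ((hcd s s0.le).symm ▸ s0)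
    have hne' : γ (t₀ + h₀) ≠ γ t₀ := dist_pos.1 ((hγd h₀ hh₀.le le_rfl).symm ▸ hh₀)
    have htri := dist_triangle_right (γ (t₀ + h)) (c s) (γ t₀)
    have habs := abs_dist_sub_le (γ (t₀ + h)) (c s) (γ t₀)
    rw [hγd h h0.le h1.le, hcd s s0.le] at htri habs
    have a1 := cosE_le_cosH h0 s0 habs htri
    have a2 := hC.cosH_le_cosH (x := γ t₀) (p := γ (t₀ + h)) (z := γ (t₀ + h₀)) (y := c s)
      (k := h₀ - h) h0 (by linarith) (hγd h h0.le h1.le)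
      (by rw [dist_comm]; exact hγ.dist_add ht h0.le h1.le hL)
      (by rw [dist_comm, hγd h₀ hh₀.le le_rfl]; ring) hne
    have a3 := hC.cosH_le_cosH (x := γ t₀) (p := c s) (z := c s₀) (y := γ (t₀ + h₀))
      (k := s₀ - s) s0 (by linarith) (hcd s s0.le)
      (by rw [hc s s₀ s0.le hs₀.le, abs_sub_comm, abs_of_pos (by linarith)])
      (by rw [dist_comm, hcd s₀ hs₀.le]; ring) hne'
    rw [hcd s s0.le, add_sub_cancel] at a2
    rw [hγd h₀ hh₀.le le_rfl, add_sub_cancel] at a3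
    rw [dist_comm (c s) (γ (t₀ + h))] at a2
    rw [dist_comm (c s) (γ (t₀ + h₀))] at a2
    rw [dist_comm (c s₀) (γ (t₀ + h₀))]
    calc _ ≤ _ := a1
      _ ≤ _ := a2
      _ = _ := by rw [mul_comm (Real.cosh h₀), mul_comm (Real.sinh h₀)]
      _ ≤ _ := a3
      _ = _ := by rw [mul_comm (Real.cosh h₀), mul_comm (Real.sinh h₀)]

/-- A `1`-Lipschitz function has directional derivatives bounded below by the cosine of the
angle with a ray along which it grows at unit speed. -/
theorem CurvGeNegK.cosAngleAt_le_liminf (hC : CurvGeNegK X 1) {b : X → ℝ}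
    (hlip : LipschitzWith 1 b) {γ : ℝ → X} {L t₀ : ℝ} (hγ : IsUnitGeodesic γ L)
    (ht : t₀ ∈ Set.Ico 0 L) {c : ℝ → X} (hc : IsRay c) (hc0 : c 0 = γ t₀)
    (hb : b (c 1) = b (γ t₀) + 1) :
    cosAngleAt (fun h => γ (t₀ + h)) c ≤
      liminf (fun h => (b (γ (t₀ + h)) - b (γ t₀)) / h) (𝓝[>] (0 : ℝ)) := by
  obtain ⟨ht0, htL⟩ := ht
  have hev : ∀ᶠ h : ℝ in 𝓝[>] (0 : ℝ), h ∈ Set.Ioo 0 (min 1 (L - t₀)) :=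
    Ioo_mem_nhdsGT (lt_min one_pos (by linarith))
  have hγd : ∀ h : ℝ, 0 ≤ h → h ≤ L - t₀ → dist (γ (t₀ + h)) (γ t₀) = h := fun h h0 h1 => by
    have := hγ.dist_add ht0 le_rfl h0 (by linarith)
    rwa [add_zero, sub_zero] at this
  set K := Real.cosh 1 / Real.sinh 1 + 1
  refine le_of_forall_pos_sub_le fun ε hε => ?_
  have hsmall : ∀ᶠ h : ℝ in 𝓝[>] (0 : ℝ), K * h < ε := by
    have : Tendsto (fun h : ℝ => K * h) (𝓝[>] 0) (𝓝 (K * 0)) :=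
      ((continuous_const_mul K).tendsto 0).mono_left nhdsWithin_le_nhds
    rw [mul_zero] at this
    exact this.eventually (gt_mem_nhds hε)
  refine le_liminf_of_le (isCoboundedUnder_ge_of_eventually_le _ (x := 1) ?_) ?_
  · filter_upwards [hev] with h ⟨h0, h1⟩
    have h2 := hlip.sub_dist_le (γ (t₀ + h)) (γ t₀)
    rw [hγd h h0.le (h1.le.trans (min_le_right _ _))] at h2
    rw [div_le_one h0]
    linarith
  · filter_upwards [hev, hsmall] with h ⟨h0, h1⟩ hK
    have hL : h ≤ L - t₀ := h1.le.trans (min_le_right _ _)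
    have a1 := hC.cosAngleAt_le hγ ht0 h0 (by linarith) one_pos hc hc0
    have hd : dist (c 1) (γ (t₀ + h)) - 1 ≤ h := by
      have := dist_triangle_right (c 1) (γ (t₀ + h)) (γ t₀)
      rw [hγd h h0.le hL, ← hc0, hc.dist_zero zero_le_one] at this
      linarith
    have a2 := cosH_le_difference_quotient h0 (h1.le.trans (min_le_left _ _)) hd
    have a3 : (1 - dist (c 1) (γ (t₀ + h))) / h ≤ (b (γ (t₀ + h)) - b (γ t₀)) / h := by
      have := hlip.sub_dist_le (c 1) (γ (t₀ + h))
      exact div_le_div_of_nonneg_right (by linarith) h0.le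
    linarith

/-- A `1`-Lipschitz function that grows at unit speed up to distance `1` from every point is
semiconvex in curvature `≥ -1`. -/
theorem CurvGeNegK.semiconvex (hC : CurvGeNegK X 1) {b : X → ℝ} (hlip : LipschitzWith 1 b)
    (hb : ∀ x, ∃ y, dist y x = 1 ∧ b y = b x + 1) : Semiconvex b := by
  intro x₀
  set K := 2 + 4 * (Real.cosh 1 / Real.sinh 1) with hK
  refine ⟨ball x₀ (1 / 2), ball_mem_nhds _ (by norm_num), 2 * K, fun γ L hγ hU => ?_⟩
  refine concaveOn_of_slope_anti_adjacent (convex_Icc 0 L) fun {r s t} hr ht hrs hst => ?_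
  have hs : s ∈ Set.Icc 0 L := ⟨hr.1.trans hrs.le, hst.le.trans ht.2⟩
  have hsmall : ∀ u ∈ Set.Icc 0 L, ∀ v ∈ Set.Icc 0 L, |u - v| ≤ 1 := fun u hu v hv => by
    rw [← hγ.2 u hu v hv]
    linarith [dist_triangle_right (γ u) (γ v) x₀, mem_ball.1 (hU u hu), mem_ball.1 (hU v hv)]
  obtain ⟨y, hy1, hyb⟩ := hb (γ s)
  have hh := sub_pos.2 hrs
  have hk := sub_pos.2 hst
  have hint := hC.dist_interpolation_le hh hk
    ((le_abs_self _).trans (hsmall s hs r hr)) ((le_abs_self _).trans (hsmall t ht s hs))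
    (by rw [hγ.2 s hs r hr, abs_of_pos hh])
    (by rw [hγ.2 s hs t ht, abs_sub_comm, abs_of_pos hk])
    (by rw [hγ.2 r hr t ht, abs_sub_comm, abs_of_pos (by linarith)]; ring) hy1
  have s1 := mul_le_mul_of_nonneg_left (hlip.sub_dist_le y (γ r)) hk.le
  have s2 := mul_le_mul_of_nonneg_left (hlip.sub_dist_le y (γ t)) hh.le
  rw [hyb] at s1 s2
  rw [div_le_div_iff₀ hk hh]
  linear_combination hint + s1 + s2

end GradientRays

/-- support functions from gradient rays, derivative bound, and
semiconvexity of `b`. -/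
theorem stmt_3 {X : Type*} [MetricSpace X]
    (n : ℕ) (hA : AlexandrovNegOne X n) (hnc : NoncompactSpace X)
    (b : X → ℝ) (hlip : LipschitzWith 1 b) (hsc : Semiconcave b)
    (σ : X → ℝ → X) (hσ0 : ∀ x, σ x 0 = x) (hray : ∀ x, IsRay (σ x))
    (hb : ∀ x, ∀ t : ℝ, 0 ≤ t → b (σ x t) = b x + t) :
    (∀ γ : ℝ → X, ∀ L : ℝ, IsUnitGeodesic γ L → ∀ t₀ ∈ Set.Icc (0:ℝ) L,
      ∀ s : ℝ, 0 < s →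
        (∀ t ∈ Set.Icc (0:ℝ) L,
          b (σ (γ t₀) s) - dist (σ (γ t₀) s) (γ t) ≤ b (γ t)) ∧
        b (γ t₀) = b (σ (γ t₀) s) - dist (σ (γ t₀) s) (γ t₀)) ∧
    (∀ γ : ℝ → X, ∀ L : ℝ, IsUnitGeodesic γ L → ∀ t₀ ∈ Set.Ico (0:ℝ) L,
      cosAngleAt (fun h => γ (t₀ + h)) (σ (γ t₀)) ≤
        Filter.liminf (fun h => (b (γ (t₀ + h)) - b (γ t₀)) / h) (𝓝[>] (0:ℝ))) ∧
    Semiconvex b := by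
  have hC := hA.1
  have hσd : ∀ x, ∀ s : ℝ, 0 ≤ s → dist (σ x s) x = s := fun x s hs => by
    simpa only [hσ0] using (hray x).dist_zero hs
  refine ⟨fun γ L _ t₀ _ s hs => ⟨fun t _ => hlip.sub_dist_le _ _, ?_⟩,
    fun γ L hγ t₀ ht => hC.cosAngleAt_le_liminf hlip hγ ht (hray _) (hσ0 _)
      (hb _ 1 zero_le_one),
    hC.semiconvex hlip fun x => ⟨σ x 1, hσd x 1 zero_le_one, hb x 1 zero_le_one⟩⟩
  rw [hσd _ s hs.le, hb _ s hs.le]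
  ring
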